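/- Let A, B, C be three affinely independent points of the Euclidean plane ℝ² and let T = convexHull ℝ {A, B, C} be the corresponding closed triangle. Then there exists a set S of tilings of ℝ² by congruent copies of T such that S has cardinality 𝔠 (the continuum) and no two distinct members of S are congruent; that is, every triangle tiles the plane in at least 𝔠 many pairwise non-congruent ways. -/

import Mathlib

open Cardinal

/-- `𝒯` is a tiling of the Euclidean plane by congruent copies of `T`: every member of `𝒯`
is the image of `T` under an isometric bijection of the plane, the members cover the plane,
and distinct members have disjoint interiors. -/
def IsTiling (T : Set (EuclideanSpace ℝ (Fin 2)))
    (𝒯 : Set (Set (EuclideanSpace ℝ (Fin 2)))) : Prop :=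
  (∀ t ∈ 𝒯, ∃ g : EuclideanSpace ℝ (Fin 2) ≃ᵢ EuclideanSpace ℝ (Fin 2), t = g '' T) ∧
    ⋃₀ 𝒯 = Set.univ ∧
    𝒯.Pairwise fun s t => Disjoint (interior s) (interior t)

/-- Two tilings are congruent if an isometric bijection of the plane maps one onto the other. -/
def CongruentTilings (𝒯 𝒯' : Set (Set (EuclideanSpace ℝ (Fin 2)))) : Prop :=
  ∃ g : EuclideanSpace ℝ (Fin 2) ≃ᵢ EuclideanSpace ℝ (Fin 2),
    𝒯' = (fun t => g '' t) '' 𝒯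

open Set

local notation "ℝ²" => EuclideanSpace ℝ (Fin 2)

theorem CongruentTilings.refl (𝒯 : Set (Set ℝ²)) : CongruentTilings 𝒯 𝒯 :=
  ⟨IsometryEquiv.refl _, by change 𝒯 = (fun t => id '' t) '' 𝒯; simp⟩

theorem CongruentTilings.symm {𝒯 𝒯' : Set (Set ℝ²)} (h : CongruentTilings 𝒯 𝒯') :
    CongruentTilings 𝒯' 𝒯 := by
  obtain ⟨g, rfl⟩ := h
  exact ⟨g.symm, by simp only [image_image, IsometryEquiv.symm_apply_apply, image_id']⟩

theorem CongruentTilings.trans {𝒯₁ 𝒯₂ 𝒯₃ : Set (Set ℝ²)} (h : CongruentTilings 𝒯₁ 𝒯₂)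
    (h' : CongruentTilings 𝒯₂ 𝒯₃) : CongruentTilings 𝒯₁ 𝒯₃ := by
  obtain ⟨g, rfl⟩ := h
  obtain ⟨g', rfl⟩ := h'
  exact ⟨g.trans g', by simp only [image_image]; rfl⟩

/-- The distances between the extreme points of the members of `𝒯`. -/
def vertexDistances (𝒯 : Set (Set ℝ²)) : Set ℝ :=
  image2 dist (⋃ t ∈ 𝒯, t.extremePoints ℝ) (⋃ t ∈ 𝒯, t.extremePoints ℝ)

theorem IsometryEquiv.map_mem_extremePoints {V W : Type*} [NormedAddCommGroup V]
    [NormedSpace ℝ V] [NormedAddCommGroup W] [NormedSpace ℝ W] (g : V ≃ᵢ W) {t : Set V} {p : V}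
    (hp : p ∈ t.extremePoints ℝ) : g p ∈ (g '' t).extremePoints ℝ := by
  rw [mem_extremePoints_iff_left] at hp ⊢
  refine ⟨mem_image_of_mem g hp.1, ?_⟩
  rintro _ ⟨x, hx, rfl⟩ _ ⟨y, hy, rfl⟩ hxy
  have h := image_openSegment ℝ g.toRealAffineIsometryEquiv.toAffineEquiv.toAffineMap x y
  have h' : g '' openSegment ℝ x y = openSegment ℝ (g x) (g y) := h
  rw [← h'] at hxy
  obtain ⟨q, hq, hqp⟩ := hxy
  rw [g.injective hqp] at hq
  rw [hp.2 x hx y hy hq]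

theorem CongruentTilings.vertexDistances_subset {𝒯 𝒯' : Set (Set ℝ²)}
    (h : CongruentTilings 𝒯 𝒯') : vertexDistances 𝒯 ⊆ vertexDistances 𝒯' := by
  obtain ⟨g, rfl⟩ := h
  rintro _ ⟨p, hp, q, hq, rfl⟩
  simp only [mem_iUnion, exists_prop] at hp hq
  obtain ⟨s, hs, hp⟩ := hp
  obtain ⟨t, ht, hq⟩ := hq
  refine ⟨g p, ?_, g q, ?_, g.dist_eq p q⟩
  · exact mem_biUnion (mem_image_of_mem _ hs) (g.map_mem_extremePoints hp)
  · exact mem_biUnion (mem_image_of_mem _ ht) (g.map_mem_extremePoints hq)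

theorem vertexDistances_countable {𝒯 : Set (Set ℝ²)} (h : 𝒯.Countable)
    (h' : ∀ t ∈ 𝒯, (t.extremePoints ℝ).Countable) : (vertexDistances 𝒯).Countable :=
  (h.biUnion h').image2 (h.biUnion h') _

theorem AffineBasis.mem_extremePoints_convexHull {ι V : Type*} [Fintype ι] [AddCommGroup V]
    [Module ℝ V] (b : AffineBasis ι ℝ V) (i : ι) :
    b i ∈ (convexHull ℝ (range b)).extremePoints ℝ := by
  rw [mem_extremePoints_iff_left]
  refine ⟨subset_convexHull ℝ _ (mem_range_self i), ?_⟩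
  have hle : ∀ z ∈ convexHull ℝ (range b), b.coord i z ≤ 1 := by
    intro z hz
    rw [b.convexHull_eq_nonneg_coord] at hz
    rw [← b.sum_coord_apply_eq_one z]
    exact Finset.single_le_sum (fun j _ => hz j) (Finset.mem_univ i)
  rintro x hx y hy ⟨r, s, hr, hs, hrs, hxy⟩
  have h1 : r * b.coord i x + s * b.coord i y = 1 := by
    have := Convex.combo_affine_apply (f := b.coord i) (x := x) (y := y) hrs
    rw [hxy, b.coord_apply_eq] at this
    simpa using this.symm
  have hx1 : b.coord i x = 1 := by
    apply le_antisymm (hle x hx)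
    have := hle y hy
    nlinarith
  rw [b.convexHull_eq_nonneg_coord] at hx
  refine b.ext_elem fun j => ?_
  obtain rfl | hj := eq_or_ne j i
  · rw [hx1, b.coord_apply_eq]
  · rw [b.coord_apply_ne hj]
    refine le_antisymm ?_ (hx j)
    have h2 : b.coord i x + b.coord j x ≤ ∑ k, b.coord k x :=
      Finset.add_le_sum (fun k _ => hx k) (Finset.mem_univ i) (Finset.mem_univ j) hj.symm
    rw [b.sum_coord_apply_eq_one] at h2
    linarith

namespace AffineBasis

variable (b : AffineBasis (Fin 3) ℝ ℝ²) (s : ℤ → ℝ)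

/-- The displacement of the `m`-th cell in the `n`-th row, that row being shifted by `s n`. -/
noncomputable def rowShift (m n : ℤ) : ℝ² :=
  (m + s n) • (b 1 - b 0) + (n : ℝ) • (b 2 - b 0)

/-- The isometry placing the triangle in a cell of a tiling by shifted rows: a translation, or
(when the first index is `false`) a point reflection. -/
noncomputable def rowIso (k : Bool × ℤ × ℤ) : ℝ² ≃ᵢ ℝ² :=
  if k.1 then IsometryEquiv.addRight (b.rowShift s k.2.1 k.2.2)
  else IsometryEquiv.subLeft (b.rowShift s k.2.1 k.2.2 + b 1 + b 2)

/-- The tiling by rows of triangles, the `n`-th row being shifted by `s n`. -/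
def rowTiling : Set (Set ℝ²) :=
  range fun k => b.rowIso s k '' convexHull ℝ (range b)

theorem coord_zero_eq (p : ℝ²) : b.coord 0 p = 1 - b.coord 1 p - b.coord 2 p := by
  have := b.sum_coord_apply_eq_one p
  rw [Fin.sum_univ_three] at this
  linarith

theorem coord_rowIso_true_symm (i : Fin 3) (m n : ℤ) (p : ℝ²) :
    b.coord i ((b.rowIso s (true, m, n)).symm p) =
      b.coord i p - (m + s n) * (b.coord i (b 1) - b.coord i (b 0)) -
        n * (b.coord i (b 2) - b.coord i (b 0)) := by
  have h : (b.rowIso s (true, m, n)).symm p = p - b.rowShift s m n := by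
    rw [IsometryEquiv.symm_apply_eq]; simp [rowIso]
  rw [h, (b.coord i).decomp]
  simp [rowShift, -linear_eq_sumCoords]
  ring

theorem coord_rowIso_false_symm (i : Fin 3) (m n : ℤ) (p : ℝ²) :
    b.coord i ((b.rowIso s (false, m, n)).symm p) =
      b.coord i (b 1) + b.coord i (b 2) - b.coord i p +
        (m + s n) * (b.coord i (b 1) - b.coord i (b 0)) +
        n * (b.coord i (b 2) - b.coord i (b 0)) := by
  have h : (b.rowIso s (false, m, n)).symm p = b.rowShift s m n + b 1 + b 2 - p := by
    rw [IsometryEquiv.symm_apply_eq]; simp [rowIso]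
  rw [h, (b.coord i).decomp]
  simp [rowShift, -linear_eq_sumCoords]
  ring

theorem mem_rowIso_image_iff (k : Bool × ℤ × ℤ) (S : Set ℝ²) (p : ℝ²) :
    p ∈ b.rowIso s k '' S ↔ (b.rowIso s k).symm p ∈ S := by
  exact (b.rowIso s k).toEquiv.image_eq_preimage_symm S ▸ Iff.rfl

theorem sUnion_rowTiling : ⋃₀ b.rowTiling s = Set.univ := by
  refine eq_univ_of_forall fun p => ?_
  set n := ⌊b.coord 2 p⌋ with hn
  set m := ⌊b.coord 1 p - s n⌋ with hm
  have hn1 := Int.floor_le (b.coord 2 p)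
  have hn2 := Int.lt_floor_add_one (b.coord 2 p)
  have hm1 := Int.floor_le (b.coord 1 p - s n)
  have hm2 := Int.lt_floor_add_one (b.coord 1 p - s n)
  rw [← hn] at hn1 hn2
  rw [← hm] at hm1 hm2
  by_cases h : b.coord 1 p - (m + s n) + (b.coord 2 p - n) ≤ 1
  · refine ⟨_, ⟨(true, m, n), rfl⟩, ?_⟩
    rw [mem_rowIso_image_iff, b.convexHull_eq_nonneg_coord]
    intro i
    rw [coord_rowIso_true_symm]
    fin_cases i <;> simp [coord_zero_eq] <;> linarith
  · refine ⟨_, ⟨(false, m, n), rfl⟩, ?_⟩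
    rw [mem_rowIso_image_iff, b.convexHull_eq_nonneg_coord]
    intro i
    rw [coord_rowIso_false_symm]
    fin_cases i <;> simp [coord_zero_eq] <;> linarith

theorem mem_interior_rowIso_image_iff (k : Bool × ℤ × ℤ) (p : ℝ²) :
    p ∈ interior (b.rowIso s k '' convexHull ℝ (range b)) ↔
      ∀ i, 0 < b.coord i ((b.rowIso s k).symm p) := by
  have h := (b.rowIso s k).toHomeomorph.image_interior (convexHull ℝ (range b))
  rw [IsometryEquiv.coe_toHomeomorph] at h
  rw [← h, mem_rowIso_image_iff, b.interior_convexHull]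
  rfl

theorem rowIndex_eq_of_mem_interior (k : Bool × ℤ × ℤ) (p : ℝ²)
    (hp : p ∈ interior (b.rowIso s k '' convexHull ℝ (range b))) :
    k.2.2 = ⌊b.coord 2 p⌋ ∧ k.2.1 = ⌊b.coord 1 p - s k.2.2⌋ ∧
      (k.1 = true ↔ b.coord 1 p - (k.2.1 + s k.2.2) + (b.coord 2 p - k.2.2) < 1) := by
  rw [mem_interior_rowIso_image_iff] at hp
  obtain ⟨ε, m, n⟩ := k
  have h0 := hp 0
  have h1 := hp 1
  have h2 := hp 2
  rw [eq_comm, Int.floor_eq_iff, eq_comm, Int.floor_eq_iff]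
  cases ε
  · rw [coord_rowIso_false_symm] at h0 h1 h2
    simp [coord_zero_eq] at h0 h1 h2 ⊢
    refine ⟨⟨?_, ?_⟩, ⟨?_, ?_⟩, ?_⟩ <;> linarith
  · rw [coord_rowIso_true_symm] at h0 h1 h2
    simp [coord_zero_eq] at h0 h1 h2 ⊢
    refine ⟨⟨?_, ?_⟩, ⟨?_, ?_⟩, ?_⟩ <;> linarith

theorem isTiling_rowTiling : IsTiling (convexHull ℝ (range b)) (b.rowTiling s) := by
  refine ⟨?_, b.sUnion_rowTiling s, ?_⟩
  · rintro _ ⟨k, rfl⟩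
    exact ⟨_, rfl⟩
  · rintro _ ⟨⟨ε, m, n⟩, rfl⟩ _ ⟨⟨ε', m', n'⟩, rfl⟩ hne
    rw [Set.disjoint_left]
    intro p hp hp'
    apply hne
    obtain ⟨h1, h2, h3⟩ := b.rowIndex_eq_of_mem_interior s _ p hp
    obtain ⟨h1', h2', h3'⟩ := b.rowIndex_eq_of_mem_interior s _ p hp'
    dsimp only at h1 h2 h3 h1' h2' h3'
    obtain rfl : n = n' := h1.trans h1'.symm
    obtain rfl : m = m' := h2.trans h2'.symm
    obtain rfl : ε = ε' := Bool.eq_iff_iff.2 (h3.trans h3'.symm)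
    rfl

theorem vertexDistances_rowTiling_countable : (vertexDistances (b.rowTiling s)).Countable := by
  refine vertexDistances_countable (countable_range _) ?_
  rintro _ ⟨k, rfl⟩
  have h : ((b.rowIso s k '' convexHull ℝ (range b)).extremePoints ℝ) ⊆
      b.rowIso s k '' range b := by
    intro p hp
    have := (b.rowIso s k).symm.map_mem_extremePoints hp
    rw [← image_comp] at this
    simp only [IsometryEquiv.symm_comp_self, image_id] at this
    rw [mem_rowIso_image_iff]
    exact extremePoints_convexHull_subset this
  exact ((countable_range b).image _).mono h

theorem shift_mul_norm_mem_vertexDistances (h0 : s 0 = 0) (h1 : 0 ≤ s (-1)) :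
    s (-1) * ‖b 1 - b 0‖ ∈ vertexDistances (b.rowTiling s) := by
  have hmem : ∀ k i, b.rowIso s k (b i) ∈ ⋃ t ∈ b.rowTiling s, t.extremePoints ℝ := fun k i =>
    mem_biUnion (mem_range_self k)
      ((b.rowIso s k).map_mem_extremePoints (b.mem_extremePoints_convexHull i))
  refine ⟨_, hmem (false, 0, -1) 1, _, hmem (true, 0, 0) 0, ?_⟩
  have h2 : b.rowIso s (false, 0, -1) (b 1) - b.rowIso s (true, 0, 0) (b 0) =
      s (-1) • (b 1 - b 0) := by
    simp [rowIso, rowShift, h0]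
    abel
  rw [dist_eq_norm, h2, norm_smul, Real.norm_of_nonneg h1]

/-- The tiling by rows of triangles in which the rows of negative index are shifted by `exp x`. -/
noncomputable def halfShiftedTiling (x : ℝ) : Set (Set ℝ²) :=
  b.rowTiling fun n => if n < 0 then Real.exp x else 0

theorem countable_setOf_congruentTilings (x : ℝ) :
    {y | CongruentTilings (b.halfShiftedTiling y) (b.halfShiftedTiling x)}.Countable := by
  have hb : ‖b 1 - b 0‖ ≠ 0 := by
    rw [norm_ne_zero_iff, sub_ne_zero]
    exact b.ind.injective.ne (by decide)
  refine MapsTo.countable_of_injOn (f := fun y => Real.exp y * ‖b 1 - b 0‖) ?_ ?_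
    (b.vertexDistances_rowTiling_countable fun n => if n < 0 then Real.exp x else 0)
  · intro y hy
    apply hy.vertexDistances_subset
    simpa [halfShiftedTiling] using b.shift_mul_norm_mem_vertexDistances (fun n => if n < 0 then Real.exp y else 0)
      (by simp) (by simp [Real.exp_nonneg])
  · intro y _ z _ h
    exact Real.exp_injective (mul_right_cancel₀ hb h)

end AffineBasis

/-- An equivalence relation with countable classes on a type of cardinality `𝔠` has `𝔠` classes. -/
theorem Cardinal.mk_quotient_eq_continuum {α : Type*} (r : Setoid α) (hα : #α = continuum)
    (hr : ∀ x, {y | r y x}.Countable) : #(Quotient r) = continuum := by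
  refine le_antisymm (hα ▸ mk_quotient_le) ?_
  by_contra! hlt
  have h := mk_le_mk_mul_of_mk_preimage_le (c := ℵ₀) (Quotient.mk r) (by
    intro q
    induction q using Quotient.inductionOn with
    | h x =>
      rw [Cardinal.le_aleph0_iff_set_countable]
      refine (hr x).mono fun y hy => ?_
      exact Quotient.exact hy)
  rw [hα] at h
  exact absurd h (not_le.2 (mul_lt_of_lt aleph0_le_continuum hlt aleph0_lt_continuum))

/-- Every (nondegenerate) triangle tiles the plane in at least `𝔠` many pairwise
non-congruent ways. -/
theorem stmt_12 (A B C : EuclideanSpace ℝ (Fin 2))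
    (hABC : AffineIndependent ℝ ![A, B, C]) :
    ∃ S : Set (Set (Set (EuclideanSpace ℝ (Fin 2)))),
      Cardinal.mk S = Cardinal.continuum ∧
        (∀ 𝒯 ∈ S, IsTiling (convexHull ℝ ({A, B, C} : Set (EuclideanSpace ℝ (Fin 2)))) 𝒯) ∧
        S.Pairwise fun 𝒯 𝒯' => ¬ CongruentTilings 𝒯 𝒯' := by
  let b : AffineBasis (Fin 3) ℝ (EuclideanSpace ℝ (Fin 2)) :=
    ⟨![A, B, C], hABC, by
      rw [hABC.affineSpan_eq_top_iff_card_eq_finrank_add_one]; simp⟩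
  have hb : ({A, B, C} : Set (EuclideanSpace ℝ (Fin 2))) = range b := by
    change _ = range ![A, B, C]
    simp only [Matrix.range_cons, Matrix.range_empty, union_empty, insert_eq]
  let r : Setoid ℝ :=
    { r := fun x y => CongruentTilings (b.halfShiftedTiling x) (b.halfShiftedTiling y)
      iseqv := ⟨fun _ => .refl _, .symm, .trans⟩ }
  let f : Quotient r → Set (Set (EuclideanSpace ℝ (Fin 2))) :=
    fun q => b.halfShiftedTiling q.out
  have hf : ∀ q q', CongruentTilings (f q) (f q') → q = q' := by
    intro q q' h
    rw [← q.out_eq, ← q'.out_eq]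
    exact Quotient.sound h
  refine ⟨range f, ?_, ?_, ?_⟩
  · rw [Cardinal.mk_range_eq f fun q q' h => hf q q' (h ▸ .refl _)]
    exact Cardinal.mk_quotient_eq_continuum r Cardinal.mk_real b.countable_setOf_congruentTilings
  · rintro _ ⟨q, rfl⟩
    rw [hb]
    exact b.isTiling_rowTiling _
  · rintro _ ⟨q, rfl⟩ _ ⟨q', rfl⟩ hne h
    exact hne (congrArg f (hf q q' h))
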